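/- Let φ, ψ > 0 with φψ⁻¹ > 1, and let H be a Borel probability measure on ℝ whose support is contained in an interval [C₀, C₁] with 0 < C₀ ≤ C₁. Let c₀ < 0 be the unique negative solution of 1 = ∫ x/(−c₀ + x·ψφ⁻¹) dH(x), and for each z < 0 let c(z) < 0 be the unique negative solution of c(z) = ∫ (z + c(z))·x/(−z − c(z) + x·ψφ⁻¹) dH(x). Then c(z) tends to c₀ as z tends to 0 from the left. -/

import Mathlib

open MeasureTheory Filter

/-- On a probability measure supported in `[C₀, C₁]` with `0 < C₀`, the kernel `x / (u + x * r)`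
is integrable for all `u, r > 0`. -/
theorem integrable_div_add_mul {C₀ C₁ u r : ℝ} (hC₀ : 0 < C₀) (hu : 0 < u) (hr : 0 < r)
    (H : Measure ℝ) [IsFiniteMeasure H] (hsupp : ∀ᵐ x ∂H, x ∈ Set.Icc C₀ C₁) :
    Integrable (fun x : ℝ => x / (u + x * r)) H := by
  refine Integrable.of_bound (C := r⁻¹)
    (measurable_id.div (by fun_prop : Measurable fun x : ℝ => u + x * r)).aestronglyMeasurable ?_
  filter_upwards [hsupp] with x hx
  have hx0 : 0 < x := hC₀.trans_le hx.1
  have hxr : 0 < x * r := mul_pos hx0 hr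
  rw [Real.norm_of_nonneg (by positivity), inv_eq_one_div, div_le_div_iff₀ (by positivity) hr]
  linarith

/-- Quantitative monotonicity of the kernel `x / (u + x * r)` in `u`. -/
theorem le_div_add_mul_sub {C₀ C₁ u v r x : ℝ} (hC₀ : 0 < C₀) (hu : 0 < u) (huv : u ≤ v)
    (hr : 0 < r) (hx : x ∈ Set.Icc C₀ C₁) :
    (v - u) / v * (C₀ * u / (u + C₁ * r) ^ 2) ≤ x / (u + x * r) - x / (v + x * r) := by
  obtain ⟨hx0, hx1⟩ := hx
  have hx' : 0 < x := hC₀.trans_le hx0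
  have hv : 0 < v := hu.trans_le huv
  have hxr : 0 < x * r := mul_pos hx' hr
  have hle : u / (u + x * r) ≤ v / (v + x * r) := by
    rw [div_le_div_iff₀ (by positivity) (by positivity)]
    nlinarith
  have hd : 0 ≤ (v - u) / v := div_nonneg (sub_nonneg.2 huv) hv.le
  have hk : C₀ * u / (u + C₁ * r) ^ 2 ≤ x * u / (u + x * r) ^ 2 := by gcongr
  calc (v - u) / v * (C₀ * u / (u + C₁ * r) ^ 2)
      ≤ (v - u) / v * (x * u / (u + x * r) ^ 2) := by gcongr
    _ = (v - u) / v * (x / (u + x * r)) * (u / (u + x * r)) := by field_simp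
    _ ≤ (v - u) / v * (x / (u + x * r)) * (v / (v + x * r)) := by gcongr
    _ = x / (u + x * r) - x / (v + x * r) := by field_simp; ring

/-- The unique negative solution `c(z)` of the `z`-dependent self-consistent equation
converges, as `z → 0⁻`, to the unique negative solution `c₀` of the limiting equation. -/
theorem negative_solution_tendsto
    (φ ψ C₀ C₁ : ℝ) (hφ : 0 < φ) (hψ : 0 < ψ) (hratio : 1 < φ * ψ⁻¹)
    (hC₀ : 0 < C₀) (hC : C₀ ≤ C₁)
    (H : Measure ℝ) [IsProbabilityMeasure H]
    (hsupp : H (Set.Icc C₀ C₁)ᶜ = 0)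
    (c₀ : ℝ) (hc₀neg : c₀ < 0)
    (hc₀ : 1 = ∫ x, x / (-c₀ + x * (ψ * φ⁻¹)) ∂H)
    (c : ℝ → ℝ)
    (hc : ∀ z : ℝ, z < 0 → c z < 0 ∧
      c z = ∫ x, (z + c z) * x / (-z - c z + x * (ψ * φ⁻¹)) ∂H) :
    Tendsto c (nhdsWithin 0 (Set.Iio 0)) (nhds c₀) := by
  have hr : 0 < ψ * φ⁻¹ := by positivity
  have hae : ∀ᵐ x ∂H, x ∈ Set.Icc C₀ C₁ := hsupp
  generalize ψ * φ⁻¹ = r at *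
  have hC₁ : 0 < C₁ := hC₀.trans_le hC
  obtain ⟨u, rfl⟩ : ∃ u, c₀ = -u := ⟨-c₀, by ring⟩
  have hu : 0 < u := by linarith
  simp only [neg_neg] at hc₀
  have hIu := integrable_div_add_mul hC₀ hu hr H hae
  set κ := C₀ * u / (u + C₁ * r) ^ 2
  have hκ0 : 0 < κ := by positivity
  have key : ∀ z < 0, -u - z + z / κ ≤ c z ∧ c z ≤ -u - z := by
    intro z hz
    obtain ⟨hcneg, heq⟩ := hc z hz
    obtain ⟨v, hv⟩ : ∃ v, v = -z - c z := ⟨_, rfl⟩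
    have hv0 : 0 < v := by linarith
    have hIv := integrable_div_add_mul hC₀ hv0 hr H hae
    rw [← hv, show z + c z = -v by linarith] at heq
    simp_rw [mul_div_assoc] at heq
    rw [integral_const_mul] at heq
    have huv : u ≤ v := by
      by_contra! h
      have hle : (1 : ℝ) ≤ ∫ x, x / (v + x * r) ∂H := by
        rw [hc₀]
        refine integral_mono_ae hIu hIv ?_
        filter_upwards [hae] with x hx
        have hx0 : 0 < x := hC₀.trans_le hx.1
        gcongr
      nlinarith
    have hgap : (v - u) / v * κ ≤ 1 - ∫ x, x / (v + x * r) ∂H := by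
      have h := integral_mono_ae (integrable_const ((v - u) / v * κ)) (hIu.sub hIv) (by
        filter_upwards [hae] with x hx
        exact le_div_add_mul_sub hC₀ hu huv hr hx)
      simp only [Pi.sub_apply] at h
      rwa [integral_sub hIu hIv, ← hc₀, integral_const, probReal_univ, one_smul] at h
    have hmul : (v - u) * κ ≤ -z := by
      have h := mul_le_mul_of_nonneg_left hgap hv0.le
      have h' : v * ((v - u) / v * κ) = (v - u) * κ := by field_simp
      linarith
    have hbound : v - u ≤ -z / κ := (le_div_iff₀ hκ0).2 hmul
    rw [neg_div] at hbound
    constructor <;> linarith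
  have hlow : Tendsto (fun z : ℝ => -u - z + z / κ) (nhdsWithin 0 (Set.Iio 0)) (nhds (-u)) :=
    ((by fun_prop : Continuous fun z : ℝ => -u - z + z / κ).tendsto' 0 _ (by simp)).mono_left
      nhdsWithin_le_nhds
  have hupp : Tendsto (fun z : ℝ => -u - z) (nhdsWithin 0 (Set.Iio 0)) (nhds (-u)) :=
    ((by fun_prop : Continuous fun z : ℝ => -u - z).tendsto' 0 _ (by simp)).mono_left
      nhdsWithin_le_nhds
  refine tendsto_of_tendsto_of_tendsto_of_le_of_le' hlow hupp ?_ ?_ <;>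
    filter_upwards [self_mem_nhdsWithin] with z hz
  exacts [(key z hz).1, (key z hz).2]
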